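/- arXiv:2208.03980 — 3 statements merged into one kernel-verified Lean document; each statement's English description precedes it below -/
import Mathlib

section
/- Let Θ° ∈ ℝ^p be the true parameter, δ > 0, μ > 0, and suppose 2μ/(μ/2 + δ) < 1. Let Θ*₀ ∈ ℝ^p be arbitrary, and for each t ≥ 1 let Γ_t : ℝ^p → ℝ^m satisfy Γ_t(Θ°) = 0 and ‖Γ_t(Θ)‖² ≥ δ‖Θ° − Θ‖² for all Θ ∈ ℝ^p, and let Θ*_t be a global minimizer of the cost J_t(Θ) = ‖Γ_t(Θ)‖² + μ‖Θ − Θ*_{t−1}‖² (i.e., J_t(Θ*_t) ≤ J_t(Θ) for all Θ ∈ ℝ^p). Then the squared estimation error ε_t = ‖Θ° − Θ*_t‖² converges to 0 as t → ∞. -/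
/-- A nonnegative real sequence that contracts by a factor `c < 1` at every step tends to `0`. -/
theorem tendsto_zero_of_le_mul {u : ℕ → ℝ} {c : ℝ} (hu : ∀ n, 0 ≤ u n) (hc0 : 0 ≤ c)
    (hc1 : c < 1) (h : ∀ n, u (n + 1) ≤ c * u n) :
    Filter.Tendsto u Filter.atTop (nhds 0) := by
  have hle : ∀ n, u n ≤ c ^ n * u 0 := fun n => by
    induction n with
    | zero => simp
    | succ n ih =>
      calc u (n + 1) ≤ c * u n := h n
        _ ≤ c * (c ^ n * u 0) := by gcongr
        _ = c ^ (n + 1) * u 0 := by ring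
  refine squeeze_zero hu hle ?_
  simpa using (tendsto_pow_atTop_nhds_zero_of_lt_one hc0 hc1).mul_const (u 0)

/-- The squared triangle inequality `‖x - y‖² ≤ 2 (‖x - z‖² + ‖y - z‖²)`. -/
theorem norm_sub_sq_le_two_mul {E : Type*} [SeminormedAddCommGroup E] (x y z : E) :
    ‖x - y‖ ^ 2 ≤ 2 * (‖x - z‖ ^ 2 + ‖y - z‖ ^ 2) := by
  have htri : ‖x - y‖ ≤ ‖x - z‖ + ‖y - z‖ := by
    simpa only [norm_sub_rev z y] using norm_sub_le_norm_sub_add_norm_sub x z y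
  calc ‖x - y‖ ^ 2 ≤ (‖x - z‖ + ‖y - z‖) ^ 2 := by gcongr
    _ ≤ 2 * (‖x - z‖ ^ 2 + ‖y - z‖ ^ 2) := add_sq_le


/-- Proposition 1: convergence of the MHE-based lifelong learning algorithm.
If `2μ/(μ/2 + δ) < 1`, each `Γ t` vanishes at the true parameter `Θo` and satisfies
the observability lower bound, and `Θ t` is a global minimizer of the MHE cost
`J_t(θ) = ‖Γ t θ‖² + μ‖θ − Θ (t−1)‖²`, then the squared estimation error
`‖Θo − Θ t‖²` tends to `0`. -/
theorem mhe_convergence (p m : ℕ) (Θo : EuclideanSpace ℝ (Fin p)) (δ μ : ℝ)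
    (hδ : 0 < δ) (hμ : 0 < μ) (hcond : 2 * μ / (μ / 2 + δ) < 1)
    (Θ : ℕ → EuclideanSpace ℝ (Fin p))
    (Γ : ℕ → EuclideanSpace ℝ (Fin p) → EuclideanSpace ℝ (Fin m))
    (hΓ0 : ∀ t, 1 ≤ t → Γ t Θo = 0)
    (hΓlb : ∀ t, 1 ≤ t → ∀ θ : EuclideanSpace ℝ (Fin p),
      δ * ‖Θo - θ‖ ^ 2 ≤ ‖Γ t θ‖ ^ 2)
    (hmin : ∀ t, 1 ≤ t → ∀ θ : EuclideanSpace ℝ (Fin p),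
      ‖Γ t (Θ t)‖ ^ 2 + μ * ‖Θ t - Θ (t - 1)‖ ^ 2 ≤
        ‖Γ t θ‖ ^ 2 + μ * ‖θ - Θ (t - 1)‖ ^ 2) :
    Filter.Tendsto (fun t => ‖Θo - Θ t‖ ^ 2) Filter.atTop (nhds 0) := by
  refine tendsto_zero_of_le_mul (fun _ => by positivity) (by positivity) hcond fun n => ?_
  have hn : 1 ≤ n + 1 := Nat.le_add_left 1 n
  have hcost := hmin (n + 1) hn Θo
  rw [hΓ0 (n + 1) hn, Nat.add_sub_cancel, norm_zero] at hcost
  have hlb := hΓlb (n + 1) hn (Θ (n + 1))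
  have htri := mul_le_mul_of_nonneg_left
    (norm_sub_sq_le_two_mul Θo (Θ (n + 1)) (Θ n)) hμ.le
  rw [div_mul_eq_mul_div, le_div_iff₀ (by positivity)]
  linarith
end

section
/- Let Θ° ∈ ℝ^p, δ > 0, μ > 0, and let Θ_prev ∈ ℝ^p. Let Γ : ℝ^p → ℝ^m satisfy Γ(Θ°) = 0 and ‖Γ(Θ)‖² ≥ δ‖Θ° − Θ‖² for all Θ ∈ ℝ^p, and let Θ* ∈ ℝ^p be a global minimizer of J(Θ) = ‖Γ(Θ)‖² + μ‖Θ − Θ_prev‖². Then ‖Θ° − Θ*‖² ≤ (2μ/(μ/2 + δ)) · ‖Θ° − Θ_prev‖². -/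
/-- One-step error contraction (equation (17)) from the proof of Proposition 1. -/
theorem mhe_one_step_contraction (p m : ℕ) (Θo Θprev : EuclideanSpace ℝ (Fin p))
    (δ μ : ℝ) (hδ : 0 < δ) (hμ : 0 < μ)
    (Γ : EuclideanSpace ℝ (Fin p) → EuclideanSpace ℝ (Fin m))
    (hΓ0 : Γ Θo = 0)
    (hΓlb : ∀ θ : EuclideanSpace ℝ (Fin p), δ * ‖Θo - θ‖ ^ 2 ≤ ‖Γ θ‖ ^ 2)
    (Θstar : EuclideanSpace ℝ (Fin p))
    (hmin : ∀ θ : EuclideanSpace ℝ (Fin p),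
      ‖Γ Θstar‖ ^ 2 + μ * ‖Θstar - Θprev‖ ^ 2 ≤ ‖Γ θ‖ ^ 2 + μ * ‖θ - Θprev‖ ^ 2) :
    ‖Θo - Θstar‖ ^ 2 ≤ (2 * μ / (μ / 2 + δ)) * ‖Θo - Θprev‖ ^ 2 := by
  have hJ := hmin Θo
  rw [hΓ0, norm_zero] at hJ
  have htri : ‖Θo - Θstar‖ ≤ ‖Θo - Θprev‖ + ‖Θstar - Θprev‖ := by
    simpa only [norm_sub_rev Θprev Θstar] using norm_sub_le_norm_sub_add_norm_sub Θo Θprev Θstar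
  have hsq : ‖Θo - Θstar‖ ^ 2 ≤ 2 * (‖Θo - Θprev‖ ^ 2 + ‖Θstar - Θprev‖ ^ 2) :=
    (pow_le_pow_left₀ (norm_nonneg _) htri 2).trans add_sq_le
  have hμsq := mul_le_mul_of_nonneg_left hsq (half_pos hμ).le
  rw [div_mul_eq_mul_div, le_div_iff₀ (by positivity)]
  linarith [hΓlb Θstar]
end

section
/- Let Θ° ∈ ℝ^p, δ > 0, μ > 0. Let Θ*₀ ∈ ℝ^p be arbitrary, and for each t ≥ 1 let Γ_t : ℝ^p → ℝ^m satisfy Γ_t(Θ°) = 0 and ‖Γ_t(Θ)‖² ≥ δ‖Θ° − Θ‖² for all Θ ∈ ℝ^p, and let Θ*_t be a global minimizer of J_t(Θ) = ‖Γ_t(Θ)‖² + μ‖Θ − Θ*_{t−1}‖². Then for every t ∈ ℕ, ‖Θ° − Θ*_t‖² ≤ (2μ/(μ/2 + δ))^t · ‖Θ° − Θ*₀‖². -/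
/-- One-step contraction: the reconstruction error after one regularized minimization step
is controlled by the error of the previous estimate. -/
theorem error_sq_le_of_regularized_minimizer {E F : Type*} [SeminormedAddCommGroup E]
    [SeminormedAddCommGroup F] {Γ : E → F} {x₀ x y : E} {δ μ : ℝ} (hδ : 0 < δ) (hμ : 0 < μ)
    (hΓ0 : Γ x₀ = 0) (hΓlb : δ * ‖x₀ - x‖ ^ 2 ≤ ‖Γ x‖ ^ 2)
    (hmin : ‖Γ x‖ ^ 2 + μ * ‖x - y‖ ^ 2 ≤ ‖Γ x₀‖ ^ 2 + μ * ‖x₀ - y‖ ^ 2) :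
    ‖x₀ - x‖ ^ 2 ≤ 2 * μ / (μ / 2 + δ) * ‖x₀ - y‖ ^ 2 := by
  have htri : ‖x₀ - x‖ ≤ ‖x₀ - y‖ + ‖x - y‖ := by
    simpa only [norm_sub_rev y x] using norm_sub_le_norm_sub_add_norm_sub x₀ y x
  have hsq : ‖x₀ - x‖ ^ 2 ≤ 2 * (‖x₀ - y‖ ^ 2 + ‖x - y‖ ^ 2) :=
    (pow_le_pow_left₀ (norm_nonneg _) htri 2).trans add_sq_le
  have hμsq := mul_le_mul_of_nonneg_left hsq hμ.le
  have hzero : ‖Γ x₀‖ ^ 2 = 0 := by simp [hΓ0]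
  rw [div_mul_eq_mul_div, le_div_iff₀ (by positivity)]
  linarith

/-- Geometric-rate form of the error dynamics (17) obtained by iterating the
one-step contraction in the proof of Proposition 1. -/
theorem mhe_geometric_rate (p m : ℕ) (Θo : EuclideanSpace ℝ (Fin p)) (δ μ : ℝ)
    (hδ : 0 < δ) (hμ : 0 < μ)
    (Θ : ℕ → EuclideanSpace ℝ (Fin p))
    (Γ : ℕ → EuclideanSpace ℝ (Fin p) → EuclideanSpace ℝ (Fin m))
    (hΓ0 : ∀ t, 1 ≤ t → Γ t Θo = 0)
    (hΓlb : ∀ t, 1 ≤ t → ∀ θ : EuclideanSpace ℝ (Fin p),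
      δ * ‖Θo - θ‖ ^ 2 ≤ ‖Γ t θ‖ ^ 2)
    (hmin : ∀ t, 1 ≤ t → ∀ θ : EuclideanSpace ℝ (Fin p),
      ‖Γ t (Θ t)‖ ^ 2 + μ * ‖Θ t - Θ (t - 1)‖ ^ 2 ≤
        ‖Γ t θ‖ ^ 2 + μ * ‖θ - Θ (t - 1)‖ ^ 2) :
    ∀ t : ℕ, ‖Θo - Θ t‖ ^ 2 ≤ (2 * μ / (μ / 2 + δ)) ^ t * ‖Θo - Θ 0‖ ^ 2 := by
  intro t
  induction t with
  | zero => simp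
  | succ t ih =>
    have ht : 1 ≤ t + 1 := Nat.le_add_left 1 t
    calc ‖Θo - Θ (t + 1)‖ ^ 2
        ≤ 2 * μ / (μ / 2 + δ) * ‖Θo - Θ t‖ ^ 2 :=
          error_sq_le_of_regularized_minimizer hδ hμ (hΓ0 _ ht) (hΓlb _ ht _) (hmin _ ht Θo)
      _ ≤ 2 * μ / (μ / 2 + δ) * ((2 * μ / (μ / 2 + δ)) ^ t * ‖Θo - Θ 0‖ ^ 2) := by gcongr
      _ = (2 * μ / (μ / 2 + δ)) ^ (t + 1) * ‖Θo - Θ 0‖ ^ 2 := by ring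
end
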